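/- Let G be a finitely generated group, let {h_n : G → A_n * B_n} be a convergent sequence of homomorphisms into free products, and let L be the associated limit group over free products with set of elliptics E_L. Let A be a non-elliptic abelian subgroup of L (an abelian subgroup containing at least one element not in E_L). Then the centralizer C(A) of A in L is abelian, every abelian subgroup of L containing A is contained in C(A) (so C(A) is the unique maximal abelian subgroup of L containing A), and the only element of C(A) that lies in E_L is the identity. -/

import Mathlib

/-- An element of the free product `X ∗ Y` is *elliptic* if it is conjugate to an element of
the canonical image of `X` or of the canonical image of `Y`. -/
def IsElliptic {X Y : Type*} [Group X] [Group Y] (x : Monoid.Coprod X Y) : Prop :=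
  ∃ c : Monoid.Coprod X Y,
    (∃ a : X, x = c * Monoid.Coprod.inl a * c⁻¹) ∨ (∃ b : Y, x = c * Monoid.Coprod.inr b * c⁻¹)

/-- A sequence of homomorphisms `h n : G →* A n ∗ B n` is *convergent* if every element of `G`
is eventually always trivial or eventually always nontrivial, and eventually always elliptic or
eventually always non-elliptic. -/
def ConvergentSeq {G : Type*} [Group G] {A B : ℕ → Type*}
    [∀ n, Group (A n)] [∀ n, Group (B n)]
    (h : ∀ n, G →* Monoid.Coprod (A n) (B n)) : Prop :=
  (∀ g : G, (∀ᶠ n in Filter.atTop, h n g = 1) ∨ (∀ᶠ n in Filter.atTop, h n g ≠ 1)) ∧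
  (∀ g : G, (∀ᶠ n in Filter.atTop, IsElliptic (h n g)) ∨
    (∀ᶠ n in Filter.atTop, ¬ IsElliptic (h n g)))

namespace Monoid.CoprodI

variable {ι : Type*} {M : ι → Type*} [∀ i, Group (M i)]

/-- The element of the free product represented by a (not necessarily reduced) list of letters. -/
def listProd (l : List (Σ i, M i)) : CoprodI M :=
  (l.map fun a => of a.2).prod

@[simp]
theorem listProd_nil : listProd ([] : List (Σ i, M i)) = 1 := rfl

@[simp]
theorem listProd_cons (a : Σ i, M i) (l : List (Σ i, M i)) :
    listProd (a :: l) = of a.2 * listProd l := by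
  simp [listProd]

@[simp]
theorem listProd_append (l l' : List (Σ i, M i)) :
    listProd (l ++ l') = listProd l * listProd l' := by
  simp [listProd]

/-- A list of letters is reduced if its letters are nontrivial and adjacent letters lie in
different factors. -/
def IsReduced (l : List (Σ i, M i)) : Prop :=
  (∀ a ∈ l, a.2 ≠ 1) ∧ l.IsChain fun a b => a.1 ≠ b.1

theorem IsReduced.eq_of_listProd_eq {l l' : List (Σ i, M i)} (hl : IsReduced l)
    (hl' : IsReduced l') (h : listProd l = listProd l') : l = l' := by
  classical
  let w : Word M := ⟨l, hl.1, hl.2⟩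
  let w' : Word M := ⟨l', hl'.1, hl'.2⟩
  have : w = w' := Word.equiv.symm.injective h
  exact congrArg Word.toList this

theorem IsReduced.append {u t : List (Σ i, M i)} {a : Σ i, M i} (hu : IsReduced (u ++ [a]))
    (ht : IsReduced (a :: t)) : IsReduced (u ++ a :: t) := by
  refine ⟨fun b hb => ?_, List.isChain_split.2 ⟨hu.2, ht.2⟩⟩
  rcases List.mem_append.1 hb with hb | hb
  · exact hu.1 b (by simp [hb])
  · exact ht.1 b hb

theorem IsReduced.left {u v : List (Σ i, M i)} (h : IsReduced (u ++ v)) : IsReduced u :=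
  ⟨fun a ha => h.1 a (by simp [ha]), h.2.left_of_append⟩

/-- A list of letters which is not reduced can be shortened. -/
theorem exists_shorter {l : List (Σ i, M i)} (h : ¬ IsReduced l) :
    ∃ l' : List (Σ i, M i), l'.length < l.length ∧ listProd l' = listProd l := by
  by_cases h1 : ∀ a ∈ l, a.2 ≠ 1
  · have h2 : ¬ l.IsChain fun a b => a.1 ≠ b.1 := fun h2 => h ⟨h1, h2⟩
    rw [List.isChain_iff_forall_rel_of_append_cons_cons] at h2
    push Not at h2
    obtain ⟨⟨i, a⟩, ⟨j, b⟩, p, q, rfl, hab⟩ := h2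
    obtain rfl : i = j := hab
    exact ⟨p ++ ⟨i, a * b⟩ :: q, by simp, by simp [mul_assoc]⟩
  · push Not at h1
    obtain ⟨a, ha, ha1⟩ := h1
    obtain ⟨p, q, rfl⟩ := List.append_of_mem ha
    exact ⟨p ++ q, by simp, by simp [ha1]⟩

theorem exists_isReduced_length_le (l : List (Σ i, M i)) :
    ∃ l' : List (Σ i, M i), IsReduced l' ∧ l'.length ≤ l.length ∧ listProd l' = listProd l := by
  induction hn : l.length using Nat.strong_induction_on generalizing l with
  | _ n ih =>
    by_cases hl : IsReduced l
    · exact ⟨l, hl, hn.le, rfl⟩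
    · obtain ⟨l₁, hlen, h₁⟩ := exists_shorter hl
      obtain ⟨l₂, hr, hle, h₂⟩ := ih _ (hn ▸ hlen) l₁ rfl
      exact ⟨l₂, hr, by omega, h₂.trans h₁⟩

theorem IsReduced.length_le {l l' : List (Σ i, M i)} (hl : IsReduced l)
    (h : listProd l = listProd l') : l.length ≤ l'.length := by
  obtain ⟨l₁, hr, hle, h₁⟩ := exists_isReduced_length_le l'
  rwa [hl.eq_of_listProd_eq hr (h.trans h₁.symm)]

theorem exists_listProd_eq (x : CoprodI M) : ∃ l : List (Σ i, M i), listProd l = x := by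
  induction x using CoprodI.induction_left with
  | one => exact ⟨[], rfl⟩
  | mul m x ih =>
    obtain ⟨l, rfl⟩ := ih
    exact ⟨⟨_, m⟩ :: l, by simp⟩

/-- Right multiplication of a nonempty reduced list by a letter: the letter is appended, cancels
the last letter, or is merged with the last letter. -/
theorem IsReduced.mul_letter {u : List (Σ i, M i)} {b : Σ i, M i} (hu : IsReduced (u ++ [b]))
    {a : Σ i, M i} (ha : a.2 ≠ 1) :
    IsReduced (u ++ [b, a]) ∨ listProd (u ++ [b]) * of a.2 = listProd u ∨
      ∃ c : Σ i, M i, c.1 = a.1 ∧ IsReduced (u ++ [c]) ∧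
        listProd (u ++ [c]) = listProd (u ++ [b]) * of a.2 := by
  obtain ⟨i, a⟩ := a
  obtain ⟨j, b⟩ := b
  by_cases hij : j = i
  · subst hij
    right
    by_cases hba : b * a = 1
    · left
      simp [mul_assoc, ← map_mul, hba]
    · refine .inr ⟨⟨j, b * a⟩, rfl, ⟨fun x hx => ?_, ?_⟩, by simp [mul_assoc]⟩
      · rcases List.mem_append.1 hx with hx | hx
        · exact hu.1 x (by simp [hx])
        · obtain rfl := List.mem_singleton.1 hx
          exact hba
      · have := hu.2
        rw [List.isChain_append] at this ⊢
        simpa using this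
  · exact .inl (hu.append ⟨by simpa using ⟨hu.1 ⟨j, b⟩ (by simp), ha⟩, by simpa using hij⟩)

/-- Right multiplication by `y` only affects the last `y.length` letters of a reduced list. -/
theorem IsReduced.mul_listProd {p q : List (Σ i, M i)} (h : IsReduced (p ++ q))
    {y : List (Σ i, M i)} (hy : y.length ≤ q.length) :
    ∃ q', IsReduced (p ++ q') ∧ listProd (p ++ q') = listProd (p ++ q) * listProd y := by
  induction y generalizing q with
  | nil => exact ⟨q, h, by simp⟩
  | cons a y ih =>
    obtain ⟨q₁, h₁, hlen, he⟩ : ∃ q₁, IsReduced (p ++ q₁) ∧ q.length ≤ q₁.length + 1 ∧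
        listProd (p ++ q₁) = listProd (p ++ q) * of a.2 := by
      rcases eq_or_ne a.2 1 with ha | ha
      · exact ⟨q, h, by simp, by simp [ha]⟩
      rcases List.eq_nil_or_concat q with rfl | ⟨v, b, rfl⟩
      · simp at hy
      rw [List.concat_eq_append] at *
      rw [← List.append_assoc] at h ⊢
      rcases h.mul_letter ha with h' | h' | ⟨c, -, h', hc⟩
      · exact ⟨v ++ [b, a], by simpa using h', by simp, by simp [mul_assoc]⟩
      · exact ⟨v, h.left, by simp, h'.symm⟩
      · exact ⟨v ++ [c], by simpa using h', by simp, by simpa using hc⟩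
    obtain ⟨q₂, h₂, he₂⟩ := ih h₁ (by simp at hy; omega)
    exact ⟨q₂, h₂, by rw [he₂, he, listProd_cons, mul_assoc]⟩

/-- The list of the `n` consecutive letters of the sequence `f` starting at index `k`. -/
def segment {α : Type*} (f : ℕ → α) (k n : ℕ) : List α :=
  (List.range n).map fun i => f (k + i)

@[simp]
theorem length_segment {α : Type*} (f : ℕ → α) (k n : ℕ) : (segment f k n).length = n := by
  simp [segment]

theorem segment_add {α : Type*} (f : ℕ → α) (k m n : ℕ) :
    segment f k (m + n) = segment f k m ++ segment f (k + m) n := by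
  simp [segment, List.range_add, add_assoc, Function.comp_def]

theorem segment_one {α : Type*} (f : ℕ → α) (k : ℕ) : segment f k 1 = [f k] := by
  simp [segment]

theorem segment_succ {α : Type*} (f : ℕ → α) (k n : ℕ) :
    segment f k (n + 1) = f k :: segment f (k + 1) n := by
  rw [add_comm, segment_add, segment_one, List.singleton_append]

theorem isReduced_segment {f : ℕ → Σ i, M i} (hone : ∀ k, (f k).2 ≠ 1)
    (hne : ∀ k, (f k).1 ≠ (f (k + 1)).1) (k n : ℕ) : IsReduced (segment f k n) := by
  refine ⟨fun a ha => ?_, ?_⟩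
  · obtain ⟨i, -, rfl⟩ := List.mem_map.1 ha
    exact hone _
  · rw [List.isChain_iff_getElem]
    intro i hi
    simpa [segment, add_assoc] using hne (k + i)

theorem IsReduced.append_segment {f : ℕ → Σ i, M i} (hone : ∀ k, (f k).2 ≠ 1)
    (hne : ∀ k, (f k).1 ≠ (f (k + 1)).1) {u : List (Σ i, M i)} {k : ℕ}
    (hu : IsReduced (u ++ [f k])) (n : ℕ) : IsReduced (u ++ segment f k n) := by
  cases n with
  | zero => simpa [segment] using hu.left
  | succ n =>
    rw [segment_succ]
    refine hu.append ?_
    rw [← segment_succ]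
    exact isReduced_segment hone hne _ _

/-- Multiplying a reduced list on the right by the letters of an alternating sequence, the
cancellation eventually stops. -/
theorem IsReduced.exists_mul_segment {f : ℕ → Σ i, M i} (hone : ∀ k, (f k).2 ≠ 1)
    (hne : ∀ k, (f k).1 ≠ (f (k + 1)).1) {u : List (Σ i, M i)} (hu : IsReduced u) (k : ℕ) :
    ∃ m u', IsReduced (u' ++ [f (k + m)]) ∧
      listProd u * listProd (segment f k m) = listProd u' := by
  induction hn : u.length generalizing u k with
  | zero =>
    obtain rfl := List.length_eq_zero_iff.1 hn
    exact ⟨0, [], by simpa [segment_one] using isReduced_segment hone hne k 1, by simp [segment]⟩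
  | succ n ih =>
    rcases List.eq_nil_or_concat u with rfl | ⟨v, b, rfl⟩
    · simp at hn
    rw [List.concat_eq_append] at *
    rcases hu.mul_letter (hone k) with h | h | ⟨c, hck, h, hc⟩
    · exact ⟨0, v ++ [b], by simpa using h, by simp [segment]⟩
    · obtain ⟨m, u', hu', he⟩ := ih hu.left (k + 1) (by simpa using hn)
      refine ⟨m + 1, u', by rwa [add_comm m, ← add_assoc], ?_⟩
      rw [segment_succ, listProd_cons, ← mul_assoc, h, he]
    · refine ⟨1, v ++ [c], ?_, by rw [segment_one, hc]; simp⟩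
      rw [List.append_assoc]
      refine h.append ⟨?_, ?_⟩
      · simpa using ⟨h.1 c (by simp), hone _⟩
      · simpa [hck] using hne k

theorem segment_add_period {α : Type*} {f : ℕ → α} {p : ℕ} (hp : ∀ k, f (k + p) = f k)
    (k n : ℕ) : segment f (k + p) n = segment f k n := by
  simp [segment, add_right_comm k p, hp]

theorem segment_add_mul_period {α : Type*} {f : ℕ → α} {p : ℕ} (hp : ∀ k, f (k + p) = f k)
    (k n j : ℕ) : segment f (k + j * p) n = segment f k n := by
  induction j with
  | zero => simp
  | succ j ih => rw [Nat.succ_mul, ← add_assoc, segment_add_period hp, ih]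

section Periodic

variable {f : ℕ → Σ i, M i} {p : ℕ}

theorem listProd_segment_mul_period (hp : ∀ k, f (k + p) = f k) (n : ℕ) :
    listProd (segment f 0 (n * p)) = listProd (segment f 0 p) ^ n := by
  induction n with
  | zero => simp [segment]
  | succ n ih =>
    rw [Nat.succ_mul, segment_add, listProd_append, ih, segment_add_mul_period hp, pow_succ]

/-- An element commuting with the product of a period of an alternating periodic sequence is, up
to multiplication by a power of this product, the product of an initial segment. -/
theorem exists_mul_pow_eq_listProd_segment (hp0 : 0 < p) (hp : ∀ k, f (k + p) = f k)
    (hone : ∀ k, (f k).2 ≠ 1) (hne : ∀ k, (f k).1 ≠ (f (k + 1)).1) {x : CoprodI M}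
    (hx : Commute x (listProd (segment f 0 p))) :
    ∃ n i : ℕ, x * listProd (segment f 0 p) ^ n = listProd (segment f 0 i) := by
  obtain ⟨l, rfl⟩ := exists_listProd_eq x
  obtain ⟨u, hu, -, hul⟩ := exists_isReduced_length_le l
  obtain ⟨m, v, hv, he⟩ := hu.exists_mul_segment hone hne 0
  rw [zero_add] at hv
  obtain ⟨j, hj⟩ : ∃ j, m * p = m + j := Nat.exists_eq_add_of_le (Nat.le_mul_of_pos_right m hp0)
  set w := v ++ segment f m j with hw
  have hxw : listProd l * listProd (segment f 0 p) ^ m = listProd w := by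
    rw [← listProd_segment_mul_period hp, hj, segment_add, listProd_append, ← mul_assoc, ← hul, he,
      zero_add, listProd_append]
  have hred (n : ℕ) : IsReduced (w ++ segment f 0 n) := by
    have := hv.append_segment hone hne (j + n)
    rwa [segment_add, ← hj, ← zero_add (m * p), segment_add_mul_period hp,
      ← List.append_assoc] at this
  have hcomm : Commute (listProd w) (listProd (segment f 0 p)) :=
    hxw ▸ hx.mul_left ((Commute.refl _).pow_left m)
  refine ⟨m, w.length, hxw.trans ?_⟩
  set r := w.length with hr
  set N := 2 * r with hN
  obtain ⟨t, ht⟩ : ∃ t, N * p = r + (r + t) := by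
    obtain ⟨t, ht⟩ := Nat.exists_eq_add_of_le (Nat.le_mul_of_pos_right N hp0)
    exact ⟨t, by omega⟩
  have hseg : segment f 0 (N * p) = segment f 0 r ++ segment f r (r + t) := by
    rw [ht, segment_add, zero_add]
  have hsr : IsReduced (segment f 0 r ++ segment f r (r + t)) :=
    hseg ▸ isReduced_segment hone hne 0 _
  obtain ⟨q, hq, hqe⟩ := hsr.mul_listProd (y := w) (by simp [← hr])
  rw [← hseg, listProd_segment_mul_period hp, ← (hcomm.pow_right N).eq,
    ← listProd_segment_mul_period hp, ← listProd_append] at hqe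
  have := hq.eq_of_listProd_eq (hred _) hqe
  rw [← (List.append_inj this (by simp [hr])).1]

theorem listProd_segment_add (hp0 : 0 < p) (hp : ∀ k, f (k + p) = f k)
    (hone : ∀ k, (f k).2 ≠ 1) (hne : ∀ k, (f k).1 ≠ (f (k + 1)).1) {i : ℕ}
    (hi : Commute (listProd (segment f 0 i)) (listProd (segment f 0 p))) (k : ℕ) :
    listProd (segment f 0 (i + k)) = listProd (segment f 0 i) * listProd (segment f 0 k) := by
  have h : segment f i (k * p) = segment f 0 (k * p) := by
    refine (isReduced_segment hone hne _ _).eq_of_listProd_eq (isReduced_segment hone hne _ _) ?_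
    refine mul_left_cancel (a := listProd (segment f 0 i)) ?_
    calc listProd (segment f 0 i) * listProd (segment f i (k * p))
        = listProd (segment f 0 (k * p + i)) := by
          rw [← listProd_append, add_comm, segment_add, zero_add]
      _ = listProd (segment f 0 (k * p)) * listProd (segment f 0 i) := by
          rw [segment_add, listProd_append, segment_add_mul_period hp]
      _ = _ := by
          rw [listProd_segment_mul_period hp, (hi.pow_right k).eq]
  obtain ⟨t, ht⟩ := Nat.exists_eq_add_of_le (Nat.le_mul_of_pos_right k hp0)
  rw [ht, segment_add, segment_add] at h
  rw [segment_add, listProd_append, zero_add, (List.append_inj h (by simp)).1]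

theorem commute_of_commute_period (hp0 : 0 < p) (hp : ∀ k, f (k + p) = f k)
    (hone : ∀ k, (f k).2 ≠ 1) (hne : ∀ k, (f k).1 ≠ (f (k + 1)).1) {x y : CoprodI M}
    (hx : Commute x (listProd (segment f 0 p))) (hy : Commute y (listProd (segment f 0 p))) :
    Commute x y := by
  set s := listProd (segment f 0 p) with hs
  obtain ⟨m, i, hi⟩ := exists_mul_pow_eq_listProd_segment hp0 hp hone hne hx
  obtain ⟨n, j, hj⟩ := exists_mul_pow_eq_listProd_segment hp0 hp hone hne hy
  rw [← hs] at hi hj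
  have hi' : Commute (listProd (segment f 0 i)) s :=
    hi ▸ hx.mul_left ((Commute.refl _).pow_left m)
  have hj' : Commute (listProd (segment f 0 j)) s :=
    hj ▸ hy.mul_left ((Commute.refl _).pow_left n)
  have hij : Commute (listProd (segment f 0 i)) (listProd (segment f 0 j)) := by
    rw [Commute, SemiconjBy, ← listProd_segment_add hp0 hp hone hne hi',
      ← listProd_segment_add hp0 hp hone hne hj', add_comm]
  rw [eq_mul_inv_of_mul_eq hi, eq_mul_inv_of_mul_eq hj]
  have hsn := ((Commute.refl s).pow_pow m n).inv_inv
  exact (hij.mul_right (hi'.pow_right n).inv_right).mul_left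
    ((hj'.pow_right m).inv_right.symm.mul_right hsn)

/-- If the powers of `x` have bounded length and `x` commutes with the product of a period of an
alternating periodic sequence, then `x` is trivial. -/
theorem eq_one_of_commute_period (hp0 : 0 < p) (hp : ∀ k, f (k + p) = f k)
    (hone : ∀ k, (f k).2 ≠ 1) (hne : ∀ k, (f k).1 ≠ (f (k + 1)).1) {x : CoprodI M}
    (hx : Commute x (listProd (segment f 0 p))) {b : ℕ}
    (hb : ∀ k : ℤ, ∃ l : List (Σ i, M i), l.length ≤ b ∧ listProd l = x ^ k) : x = 1 := by
  have hlen (k : ℤ) (n : ℕ) (h : x ^ k = listProd (segment f 0 p) ^ n) : n ≤ b := by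
    obtain ⟨l, hl, hlx⟩ := hb k
    have := (isReduced_segment hone hne 0 (n * p)).length_le
      ((listProd_segment_mul_period hp n).trans (h.symm.trans hlx.symm))
    rw [length_segment] at this
    exact (Nat.le_mul_of_pos_right n hp0).trans (this.trans hl)
  obtain ⟨m, i, hi⟩ := exists_mul_pow_eq_listProd_segment hp0 hp hone hne hx
  set s := listProd (segment f 0 p) with hs
  have hi' : Commute (listProd (segment f 0 i)) s :=
    hi ▸ hx.mul_left ((Commute.refl _).pow_left m)
  have hpow (n : ℕ) : listProd (segment f 0 (n * i)) = listProd (segment f 0 i) ^ n := by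
    induction n with
    | zero => simp [segment]
    | succ n ih =>
      rw [Nat.succ_mul, add_comm, listProd_segment_add hp0 hp hone hne hi', ih, pow_succ']
  have key : x ^ p * s ^ (m * p) = s ^ i := by
    rw [pow_mul, ← (hx.pow_right m).mul_pow, hi, ← hpow, mul_comm, listProd_segment_mul_period hp]
  rcases lt_trichotomy i (m * p) with h | h | h
  · obtain ⟨t, ht⟩ := Nat.exists_eq_add_of_lt h
    have hxt : x⁻¹ ^ p = s ^ (t + 1) := by
      rw [ht, add_assoc, add_comm i, pow_add, ← mul_assoc, mul_eq_right] at key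
      rw [inv_pow, inv_eq_of_mul_eq_one_right key]
    have := hlen (-(p * (b + 1) : ℕ)) ((t + 1) * (b + 1)) <| by
      rw [zpow_neg, zpow_natCast, pow_mul, pow_mul, ← inv_pow, ← inv_pow, hxt]
    nlinarith
  · rw [h, listProd_segment_mul_period hp, mul_eq_right] at hi
    exact hi
  · obtain ⟨t, ht⟩ := Nat.exists_eq_add_of_lt h
    have hxt : x ^ p = s ^ (t + 1) := by
      rw [ht, add_assoc, add_comm (m * p), pow_add] at key
      exact mul_right_cancel key
    have := hlen (p * (b + 1) : ℕ) ((t + 1) * (b + 1)) <| by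
      rw [zpow_natCast, pow_mul, pow_mul, hxt]
    nlinarith

end Periodic

theorem exists_list_zpow_of_conj (c : CoprodI M) {i : ι} (a : M i) :
    ∃ b : ℕ, ∀ k : ℤ, ∃ l : List (Σ i, M i), l.length ≤ b ∧
      listProd l = (c * of a * c⁻¹) ^ k := by
  obtain ⟨l, hl⟩ := exists_listProd_eq c
  obtain ⟨l', hl'⟩ := exists_listProd_eq c⁻¹
  refine ⟨l.length + (l'.length + 1), fun k => ⟨l ++ ⟨i, a ^ k⟩ :: l', by simp, ?_⟩⟩
  rw [conj_zpow, listProd_append, listProd_cons, hl, hl', map_zpow, mul_assoc]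

theorem isConj_listProd_rotate (l : List (Σ i, M i)) (k : ℕ) :
    IsConj (listProd l) (listProd (l.rotate k)) := by
  rw [List.rotate_eq_drop_append_take_mod, listProd_append]
  nth_rw 1 [← List.take_append_drop (k % l.length) l]
  rw [listProd_append, isConj_iff]
  exact ⟨(listProd (l.take (k % l.length)))⁻¹, by group⟩

/-- An element which is not conjugate into a factor is conjugate to the product of a period of an
alternating periodic sequence of nontrivial letters. -/
theorem exists_periodic_of_not_conj [Nonempty ι] {s : CoprodI M}
    (hs : ∀ (c : CoprodI M) (i : ι) (a : M i), s ≠ c * of a * c⁻¹) :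
    ∃ (c : CoprodI M) (f : ℕ → Σ i, M i) (p : ℕ), 0 < p ∧ (∀ k, f (k + p) = f k) ∧
      (∀ k, (f k).2 ≠ 1) ∧ (∀ k, (f k).1 ≠ (f (k + 1)).1) ∧
      c * s * c⁻¹ = listProd (segment f 0 p) := by
  classical
  have hex : ∃ n, ∃ l : List (Σ i, M i), l.length = n ∧ IsConj s (listProd l) := by
    obtain ⟨l, rfl⟩ := exists_listProd_eq s
    exact ⟨_, l, rfl, IsConj.refl _⟩
  obtain ⟨L, hL, hsL⟩ := Nat.find_spec hex
  have hmin (l : List (Σ i, M i)) (hl : IsConj s (listProd l)) : L.length ≤ l.length :=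
    hL ▸ Nat.find_min' hex ⟨l, rfl, hl⟩
  have hrot (k : ℕ) : IsReduced (L.rotate k) := by
    by_contra hred
    obtain ⟨l, hlt, hl⟩ := exists_shorter hred
    exact absurd (hmin l (hl ▸ hsL.trans (isConj_listProd_rotate L k))) (by simpa using hlt)
  obtain ⟨c, hc⟩ := isConj_iff.1 hsL
  have hsc : s = c⁻¹ * listProd L * c⁻¹⁻¹ := by rw [← hc]; group
  have hlen : 1 < L.length := by
    by_contra! hle
    rcases Nat.le_one_iff_eq_zero_or_eq_one.1 hle with h0 | h1
    · obtain rfl := List.length_eq_zero_iff.1 h0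
      obtain ⟨i⟩ := ‹Nonempty ι›
      exact hs c⁻¹ i 1 (by simpa using hsc)
    · obtain ⟨⟨i, a⟩, rfl⟩ := List.length_eq_one_iff.1 h1
      exact hs c⁻¹ i a (by simpa using hsc)
  have hpos : 0 < L.length := by omega
  refine ⟨c, fun k => L[k % L.length]'(Nat.mod_lt _ hpos), L.length, hpos, fun k => by simp,
    fun k => (hrot 0).1 _ (by simp), fun k => ?_, ?_⟩
  · have := List.isChain_iff_getElem.1 (hrot k).2 0 (by simpa using hlen)
    simpa [List.getElem_rotate, add_comm 1 k] using this
  · rw [hc]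
    congr 1
    refine List.ext_getElem (by simp) fun i h₁ _ => ?_
    simp [segment, Nat.mod_eq_of_lt h₁]

theorem commute_of_commute_of_not_conj [Nonempty ι] {s x y : CoprodI M}
    (hs : ∀ (c : CoprodI M) (i : ι) (a : M i), s ≠ c * of a * c⁻¹)
    (hx : Commute x s) (hy : Commute y s) : Commute x y := by
  obtain ⟨c, f, p, hp0, hp, hone, hne, hc⟩ := exists_periodic_of_not_conj hs
  rw [← MulAut.conj_apply] at hc
  exact .of_map (MulAut.conj c).injective <| commute_of_commute_period hp0 hp hone hne
    (hc ▸ hx.map (MulAut.conj c)) (hc ▸ hy.map (MulAut.conj c))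

theorem eq_one_of_commute_of_not_conj [Nonempty ι] {s : CoprodI M}
    (hs : ∀ (c : CoprodI M) (i : ι) (a : M i), s ≠ c * of a * c⁻¹) (d : CoprodI M) {i : ι}
    (a : M i) (hx : Commute (d * of a * d⁻¹) s) : d * of a * d⁻¹ = 1 := by
  obtain ⟨c, f, p, hp0, hp, hone, hne, hc⟩ := exists_periodic_of_not_conj hs
  rw [← MulAut.conj_apply] at hc
  obtain ⟨b, hb⟩ := exists_list_zpow_of_conj (c * d) a
  refine (MulAut.conj c).injective ?_
  rw [map_one]
  refine eq_one_of_commute_period hp0 hp hone hne (hc ▸ hx.map (MulAut.conj c)) (b := b) ?_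
  convert hb using 5
  simp [mul_assoc]

end Monoid.CoprodI

namespace Monoid.Coprod

universe u v

variable {X : Type u} {Y : Type v} [Group X] [Group Y]

/-- The two factors of a binary free product, as a family indexed by `Bool`. -/
def Factor (X : Type u) (Y : Type v) : Bool → Type (max u v)
  | true => ULift.{v} X
  | false => ULift.{u} Y

instance : ∀ b, Group (Factor X Y b)
  | true => inferInstanceAs (Group (ULift X))
  | false => inferInstanceAs (Group (ULift Y))

/-- The inclusion of the first factor in the indexed free product. -/
def ofLeft : X →* CoprodI (Factor X Y) :=
  (CoprodI.of (M := Factor X Y) (i := true)).comp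
    (MulEquiv.ulift.symm : X ≃* ULift.{v} X).toMonoidHom

/-- The inclusion of the second factor in the indexed free product. -/
def ofRight : Y →* CoprodI (Factor X Y) :=
  (CoprodI.of (M := Factor X Y) (i := false)).comp
    (MulEquiv.ulift.symm : Y ≃* ULift.{u} Y).toMonoidHom

/-- The map from the indexed free product of the two factors to the binary free product. -/
def ofCoprodI : CoprodI (Factor X Y) →* Coprod X Y :=
  CoprodI.lift fun
    | true => inl.comp (MulEquiv.ulift : ULift.{v} X ≃* X).toMonoidHom
    | false => inr.comp (MulEquiv.ulift : ULift.{u} Y ≃* Y).toMonoidHom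

theorem ofCoprodI_ofLeft (a : X) : ofCoprodI (ofLeft a : CoprodI (Factor X Y)) = inl a :=
  CoprodI.lift_of _ (i := true) _

theorem ofCoprodI_ofRight (b : Y) : ofCoprodI (ofRight b : CoprodI (Factor X Y)) = inr b :=
  CoprodI.lift_of _ (i := false) _

/-- The binary free product as an indexed free product. -/
def equivCoprodI : Coprod X Y ≃* CoprodI (Factor X Y) :=
  MonoidHom.toMulEquiv (lift ofLeft ofRight) ofCoprodI
    (hom_ext (MonoidHom.ext fun a => by simp [ofCoprodI_ofLeft])
      (MonoidHom.ext fun b => by simp [ofCoprodI_ofRight]))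
    (CoprodI.ext_hom _ _ fun
      | true => MonoidHom.ext fun a =>
        (congrArg (lift ofLeft ofRight) (ofCoprodI_ofLeft a.down)).trans (lift_apply_inl _ _ _)
      | false => MonoidHom.ext fun b =>
        (congrArg (lift ofLeft ofRight) (ofCoprodI_ofRight b.down)).trans (lift_apply_inr _ _ _))

theorem equivCoprodI_inl (a : X) : equivCoprodI (inl a : Coprod X Y) = ofLeft a :=
  lift_apply_inl ofLeft ofRight a

theorem equivCoprodI_inr (b : Y) : equivCoprodI (inr b : Coprod X Y) = ofRight b :=
  lift_apply_inr ofLeft ofRight b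

theorem isElliptic_iff_conj_of {x : Coprod X Y} : IsElliptic x ↔
    ∃ (c : CoprodI (Factor X Y)) (i : Bool) (a : Factor X Y i),
      equivCoprodI x = c * CoprodI.of a * c⁻¹ := by
  constructor
  · rintro ⟨c, ⟨a, rfl⟩ | ⟨b, rfl⟩⟩
    · exact ⟨equivCoprodI c, true, ULift.up a, by simp [equivCoprodI_inl]; rfl⟩
    · exact ⟨equivCoprodI c, false, ULift.up b, by simp [equivCoprodI_inr]; rfl⟩
  · rintro ⟨c, i, a, h⟩
    obtain ⟨c, rfl⟩ := equivCoprodI.surjective c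
    refine ⟨c, ?_⟩
    cases i
    · refine .inr ⟨ULift.down a, equivCoprodI.injective ?_⟩
      rw [h, map_mul, map_mul, map_inv, equivCoprodI_inr]
      rfl
    · refine .inl ⟨ULift.down a, equivCoprodI.injective ?_⟩
      rw [h, map_mul, map_mul, map_inv, equivCoprodI_inl]
      rfl

theorem commute_of_commute_of_not_isElliptic {s x y : Coprod X Y} (hs : ¬ IsElliptic s)
    (hx : Commute x s) (hy : Commute y s) : Commute x y := by
  rw [isElliptic_iff_conj_of] at hs
  push Not at hs
  exact .of_map equivCoprodI.injective <| CoprodI.commute_of_commute_of_not_conj hs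
    (hx.map equivCoprodI) (hy.map equivCoprodI)

theorem eq_one_of_isElliptic_of_commute {s x : Coprod X Y} (hs : ¬ IsElliptic s)
    (hxe : IsElliptic x) (hx : Commute x s) : x = 1 := by
  rw [isElliptic_iff_conj_of] at hs hxe
  push Not at hs
  obtain ⟨c, i, a, h⟩ := hxe
  rw [← map_eq_one_iff equivCoprodI equivCoprodI.injective, h]
  exact CoprodI.eq_one_of_commute_of_not_conj hs c a (h ▸ hx.map equivCoprodI)

end Monoid.Coprod

/-- In a limit group `L` over free products, the centralizer of a non-elliptic abelian subgroup
`S` is abelian, it contains every abelian subgroup of `L` containing `S` (so it is the unique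
maximal abelian subgroup containing `S`), and it meets the set of elliptics only in the
identity. -/
theorem centralizer_of_nonelliptic_abelian
    {G L : Type*} [Group G] [Group.FG G] [Group L] {A B : ℕ → Type*}
    [∀ n, Group (A n)] [∀ n, Group (B n)]
    (h : ∀ n, G →* Monoid.Coprod (A n) (B n)) (hconv : ConvergentSeq h)
    (η : G →* L) (hsurj : Function.Surjective η)
    (hker : ∀ g : G, η g = 1 ↔ ∀ᶠ n in Filter.atTop, h n g = 1)
    (E : Set L)
    (hE : E = {l : L | ∃ g : G, η g = l ∧ ∀ᶠ n in Filter.atTop, IsElliptic (h n g)})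
    (S : Subgroup L) (habel : ∀ x ∈ S, ∀ y ∈ S, Commute x y)
    (hnonell : ∃ a ∈ S, a ∉ E) :
    (∀ x ∈ Subgroup.centralizer (S : Set L), ∀ y ∈ Subgroup.centralizer (S : Set L),
      Commute x y) ∧
    (∀ T : Subgroup L, (∀ x ∈ T, ∀ y ∈ T, Commute x y) → S ≤ T →
      T ≤ Subgroup.centralizer (S : Set L)) ∧
    (∀ x ∈ Subgroup.centralizer (S : Set L), x ∈ E → x = 1) := by
  subst hE
  obtain ⟨a, haS, haE⟩ := hnonell
  obtain ⟨g, rfl⟩ := hsurj a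
  have hg : ∀ᶠ n in Filter.atTop, ¬ IsElliptic (h n g) :=
    (hconv.2 g).resolve_left fun hell => haE ⟨g, rfl, hell⟩
  have hcomm {x y : G} : Commute (η x) (η y) ↔ ∀ᶠ n in Filter.atTop, Commute (h n x) (h n y) := by
    simp only [← commutatorElement_eq_one_iff_commute, ← map_commutatorElement, hker]
  refine ⟨fun x hx y hy => ?_, fun T hT hST x hx => ?_, ?_⟩
  · obtain ⟨x, rfl⟩ := hsurj x
    obtain ⟨y, rfl⟩ := hsurj y
    have hxg : Commute (η x) (η g) := (Subgroup.mem_centralizer_iff.1 hx _ haS).symm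
    have hyg : Commute (η y) (η g) := (Subgroup.mem_centralizer_iff.1 hy _ haS).symm
    rw [hcomm] at hxg hyg ⊢
    filter_upwards [hg, hxg, hyg] with n hgn hxn hyn
    exact Monoid.Coprod.commute_of_commute_of_not_isElliptic hgn hxn hyn
  · exact Subgroup.mem_centralizer_iff.2 fun y hy => hT y (hST hy) x hx
  · rintro _ hx ⟨x, rfl, hell⟩
    have hxg : Commute (η x) (η g) := (Subgroup.mem_centralizer_iff.1 hx _ haS).symm
    rw [hcomm] at hxg
    rw [hker]
    filter_upwards [hg, hxg, hell] with n hgn hxn hxe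
    exact Monoid.Coprod.eq_one_of_isElliptic_of_commute hgn hxe hxn
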